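/- Let Ω be a nonempty open convex proper subset of ℝⁿ (n ≥ 2). Then ∂Ω is locally a Lipschitz graph: for every z ∈ ∂Ω there exist a unit vector e ∈ ℝⁿ, a radius r > 0, a constant L ≥ 0, and an L-Lipschitz function f : e^⊥ → ℝ defined on the orthogonal complement of e, such that Ω ∩ B_r(z) = { w + t e : w ∈ e^⊥, t > f(w) } ∩ B_r(z) and ∂Ω ∩ B_r(z) = { w + f(w) e : w ∈ e^⊥ } ∩ B_r(z). -/

import Mathlib

open Set Metric
open scoped RealInnerProductSpace

theorem convex_frontier_locally_lipschitz_graph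
    (n : ℕ) (hn : 2 ≤ n)
    (Ω : Set (EuclideanSpace ℝ (Fin n)))
    (hne : Ω.Nonempty) (hopen : IsOpen Ω) (hconv : Convex ℝ Ω) (hproper : Ω ≠ univ) :
    ∀ z ∈ frontier Ω,
      ∃ (e : EuclideanSpace ℝ (Fin n)) (r L : ℝ)
        (f : EuclideanSpace ℝ (Fin n) → ℝ),
        ‖e‖ = 1 ∧ 0 < r ∧ 0 ≤ L ∧
        (∀ w w', ⟪w, e⟫ = 0 → ⟪w', e⟫ = 0 → |f w - f w'| ≤ L * ‖w - w'‖) ∧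
        Ω ∩ Metric.ball z r
          = {p | ∃ (w : EuclideanSpace ℝ (Fin n)) (t : ℝ),
              ⟪w, e⟫ = 0 ∧ f w < t ∧ p = w + t • e} ∩ Metric.ball z r ∧
        frontier Ω ∩ Metric.ball z r
          = {p | ∃ w : EuclideanSpace ℝ (Fin n),
              ⟪w, e⟫ = 0 ∧ p = w + f w • e} ∩ Metric.ball z r := by
  intro z hz
  have hzΩ : z ∉ Ω := by
    rw [hopen.frontier_eq] at hz
    exact hz.2
  have hzc : z ∈ closure Ω := frontier_subset_closure hz
  obtain ⟨x0, hx0⟩ := hne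
  obtain ⟨ρ, hρ, hball⟩ := Metric.isOpen_iff.1 hopen x0 hx0
  set d : ℝ := ‖x0 - z‖ with hd
  have hρd : ρ ≤ d := by
    by_contra h
    push Not at h
    apply hzΩ
    apply hball
    rw [Metric.mem_ball, dist_comm, dist_eq_norm]
    exact h
  have hd0 : 0 < d := lt_of_lt_of_le hρ hρd
  set e : EuclideanSpace ℝ (Fin n) := d⁻¹ • (x0 - z) with he
  have hde : d • e = x0 - z := by
    rw [he, smul_smul, mul_inv_cancel₀ hd0.ne', one_smul]
  have hen : ‖e‖ = 1 := by
    rw [he, norm_smul, Real.norm_of_nonneg (inv_nonneg.2 hd0.le), ← hd, inv_mul_cancel₀ hd0.ne']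
  have hee : ⟪e, e⟫ = 1 := by
    rw [real_inner_self_eq_norm_sq, hen]; norm_num
  clear_value e
  set r : ℝ := ρ / 2 with hr
  set L : ℝ := 2 * d / ρ with hL
  have hr0 : 0 < r := by positivity
  have hL0 : 0 < L := by positivity
  have hLd : d / L = ρ / 2 := by
    rw [hL]; field_simp
  obtain ⟨s0, hs0, hs0'⟩ := Metric.mem_closure_iff.1 hzc r hr0
  let S : Set (EuclideanSpace ℝ (Fin n)) := Ω ∩ Metric.ball z r
  haveI : Nonempty S := ⟨⟨s0, hs0, by rwa [Metric.mem_ball, dist_comm]⟩⟩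
  let g : S → EuclideanSpace ℝ (Fin n) → ℝ :=
    fun s w => ⟪s.1, e⟫ + L * ‖w - (s.1 - ⟪s.1, e⟫ • e)‖
  let f : EuclideanSpace ℝ (Fin n) → ℝ := fun w => ⨅ s : S, g s w
  have hbdd : ∀ w, BddBelow (Set.range fun s : S => g s w) := by
    intro w
    refine ⟨-(‖z‖ + r), ?_⟩
    rintro _ ⟨s, rfl⟩
    have h1 : |⟪s.1, e⟫| ≤ ‖s.1‖ * ‖e‖ := abs_real_inner_le_norm _ _
    rw [hen, mul_one] at h1
    have h2 : ‖s.1‖ ≤ ‖z‖ + r := by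
      have h3 : ‖s.1 - z‖ < r := by
        rw [← dist_eq_norm]; exact s.2.2
      have h4 := norm_le_norm_add_norm_sub' s.1 z
      linarith
    have h5 : 0 ≤ L * ‖w - (s.1 - ⟪s.1, e⟫ • e)‖ := by positivity
    have h6 := (abs_le.1 h1).1
    change -(‖z‖ + r) ≤ ⟪s.1, e⟫ + L * ‖w - (s.1 - ⟪s.1, e⟫ • e)‖
    linarith
  have hlip1 : ∀ w w', f w ≤ f w' + L * ‖w - w'‖ := by
    intro w w'
    rw [← sub_le_iff_le_add]
    apply le_ciInf
    intro s
    have h1 : f w ≤ g s w := ciInf_le (hbdd w) s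
    have h2 : ‖w - (s.1 - ⟪s.1, e⟫ • e)‖ ≤ ‖w - w'‖ + ‖w' - (s.1 - ⟪s.1, e⟫ • e)‖ :=
      norm_sub_le_norm_sub_add_norm_sub _ _ _
    have h3 := mul_le_mul_of_nonneg_left h2 hL0.le
    have h4 : g s w = ⟪s.1, e⟫ + L * ‖w - (s.1 - ⟪s.1, e⟫ • e)‖ := rfl
    have h5 : g s w' = ⟪s.1, e⟫ + L * ‖w' - (s.1 - ⟪s.1, e⟫ • e)‖ := rfl
    rw [h5]
    rw [h4] at h1
    linarith
  have hlip : ∀ w w', |f w - f w'| ≤ L * ‖w - w'‖ := by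
    intro w w'
    have h1 := hlip1 w w'
    have h2 := hlip1 w' w
    rw [norm_sub_rev] at h2
    rw [abs_le]
    constructor <;> linarith
  have hfc : Continuous f := by
    have : LipschitzWith L.toNNReal f := by
      apply LipschitzWith.of_dist_le_mul
      intro w w'
      rw [Real.dist_eq, dist_eq_norm, Real.coe_toNNReal _ hL0.le]
      exact hlip w w'
    exact this.continuous
  let F : EuclideanSpace ℝ (Fin n) → ℝ := fun p => ⟪p, e⟫ - f (p - ⟪p, e⟫ • e)
  have hFc : Continuous F := by
    have h1 : Continuous fun p : EuclideanSpace ℝ (Fin n) => ⟪p, e⟫ := by fun_prop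
    exact h1.sub (hfc.comp (continuous_id.sub (h1.smul continuous_const)))
  have hperp : ∀ p : EuclideanSpace ℝ (Fin n), ⟪p - ⟪p, e⟫ • e, e⟫ = 0 := by
    intro p
    rw [inner_sub_left, real_inner_smul_left, hee]; ring
  have hin : ∀ (w : EuclideanSpace ℝ (Fin n)) (t : ℝ), ⟪w, e⟫ = 0 → ⟪w + t • e, e⟫ = t := by
    intro w t hw
    rw [inner_add_left, real_inner_smul_left, hee, hw]; ring
  have hF : ∀ (w : EuclideanSpace ℝ (Fin n)) (t : ℝ), ⟪w, e⟫ = 0 → F (w + t • e) = t - f w := by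
    intro w t hw
    change ⟪w + t • e, e⟫ - f (w + t • e - ⟪w + t • e, e⟫ • e) = t - f w
    rw [hin w t hw, add_sub_cancel_right]
  have hFadd : ∀ (p : EuclideanSpace ℝ (Fin n)) (t : ℝ), F (p + t • e) = F p + t := by
    intro p t
    have h1 : p + t • e = (p - ⟪p, e⟫ • e) + (⟪p, e⟫ + t) • e := by
      rw [add_smul]; abel
    rw [h1, hF _ _ (hperp p)]
    change _ = ⟪p, e⟫ - f (p - ⟪p, e⟫ • e) + t
    ring
  have hS : ∀ p ∈ S, 0 ≤ F p := by
    intro p hp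
    have h1 : f (p - ⟪p, e⟫ • e) ≤ g ⟨p, hp⟩ (p - ⟪p, e⟫ • e) := ciInf_le (hbdd _) ⟨p, hp⟩
    have h2 : g ⟨p, hp⟩ (p - ⟪p, e⟫ • e) = ⟪p, e⟫ := by
      simp [g]
    change 0 ≤ ⟪p, e⟫ - f (p - ⟪p, e⟫ • e)
    linarith
  have hSo : IsOpen S := hopen.inter Metric.isOpen_ball
  have hSF : ∀ p ∈ S, 0 < F p := by
    intro p hp
    have hc : Continuous fun t : ℝ => p + (-t) • e := by fun_prop
    have h0 : (fun t : ℝ => p + (-t) • e) 0 ∈ S := by simpa using hp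
    obtain ⟨δ, hδ, hδS⟩ := Metric.isOpen_iff.1 (hSo.preimage hc) 0 h0
    have h1 : (δ / 2) ∈ Metric.ball (0 : ℝ) δ := by
      rw [Metric.mem_ball, Real.dist_eq, sub_zero, abs_of_pos (by positivity)]
      linarith
    have h2 := hS _ (hδS h1)
    rw [hFadd] at h2
    linarith
  have hFS : ∀ p ∈ Metric.ball z r, 0 < F p → p ∈ Ω := by
    intro p hp hFp
    have h1 : f (p - ⟪p, e⟫ • e) < ⟪p, e⟫ := by
      have h : 0 < ⟪p, e⟫ - f (p - ⟪p, e⟫ • e) := hFp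
      linarith
    obtain ⟨s, hs⟩ := exists_lt_of_ciInf_lt h1
    have hs1 : ⟪s.1, e⟫ + L * ‖p - ⟪p, e⟫ • e - (s.1 - ⟪s.1, e⟫ • e)‖ < ⟪p, e⟫ := hs
    obtain ⟨s, hsΩ, hsB⟩ := s
    simp only at hs1
    set a : ℝ := ⟪p, e⟫ - ⟪s, e⟫ with ha
    set u : EuclideanSpace ℝ (Fin n) := p - ⟪p, e⟫ • e - (s - ⟪s, e⟫ • e) with hu
    have hLu : L * ‖u‖ < a := by linarith
    have ha0 : 0 < a := lt_of_le_of_lt (by positivity) hLu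
    have hps : p = s + (a • e + u) := by
      rw [hu, ha, sub_smul]; abel
    have hsz : ‖s - z‖ < r := by rw [← dist_eq_norm]; exact hsB
    have hpz : ‖p - z‖ < r := by rw [← dist_eq_norm]; exact hp
    have had : a ≤ d := by
      have h2 : a = ⟪p - s, e⟫ := by rw [inner_sub_left]
      have h3 : ⟪p - s, e⟫ ≤ ‖p - s‖ * ‖e‖ := real_inner_le_norm _ _
      rw [hen, mul_one] at h3
      have h4 : ‖p - s‖ ≤ ‖p - z‖ + ‖z - s‖ := norm_sub_le_norm_sub_add_norm_sub _ _ _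
      rw [norm_sub_rev z s] at h4
      linarith
    clear_value a u
    have hy : s + d • e + (d / a) • u ∈ Ω := by
      apply hball
      rw [Metric.mem_ball, dist_eq_norm]
      have h2 : s + d • e + (d / a) • u - x0 = (s - z) + (d / a) • u := by
        rw [hde]; abel
      have h3 : ‖(d / a) • u‖ ≤ ρ / 2 := by
        rw [norm_smul, Real.norm_of_nonneg (by positivity), ← hLd, div_mul_eq_mul_div,
          div_le_div_iff₀ ha0 hL0]
        nlinarith
      rw [h2]
      have h4 := norm_add_le (s - z) ((d / a) • u)
      linarith
    have hda : a / d ≤ 1 := (div_le_one hd0).2 had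
    have h5 := hconv hsΩ hy (sub_nonneg.2 hda) (by positivity : 0 ≤ a / d) (by ring)
    have h6 : (1 - a / d) • s + (a / d) • (s + d • e + (d / a) • u) = p := by
      rw [hps, smul_add, smul_add, smul_smul, smul_smul, div_mul_cancel₀ _ hd0.ne',
        div_mul_div_cancel₀ hd0.ne', div_self ha0.ne', sub_smul, one_smul, one_smul]
      abel
    rwa [h6] at h5
  have hkey : Ω ∩ Metric.ball z r = {p | 0 < F p} ∩ Metric.ball z r := by
    ext p
    exact ⟨fun hp => ⟨hSF p hp, hp.2⟩, fun hp => ⟨hFS p hp.2 hp.1, hp.2⟩⟩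
  refine ⟨e, r, L, f, hen, hr0, hL0.le, fun w w' _ _ => hlip w w', ?_, ?_⟩
  · rw [hkey]
    congr 1
    ext p
    constructor
    · intro hp
      have h : 0 < ⟪p, e⟫ - f (p - ⟪p, e⟫ • e) := hp
      exact ⟨p - ⟪p, e⟫ • e, ⟪p, e⟫, hperp p, by linarith, by abel⟩
    · rintro ⟨w, t, hw, ht, rfl⟩
      change 0 < F (w + t • e)
      rw [hF w t hw]
      linarith
  · rw [← frontier_inter_open_inter Metric.isOpen_ball, hkey,
      frontier_inter_open_inter Metric.isOpen_ball]
    congr 1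
    ext p
    constructor
    · intro hp
      have h : (0 : ℝ) = F p := frontier_lt_subset_eq continuous_const hFc hp
      have h' : (0 : ℝ) = ⟪p, e⟫ - f (p - ⟪p, e⟫ • e) := h
      have h2 : f (p - ⟪p, e⟫ • e) = ⟪p, e⟫ := by linarith
      refine ⟨p - ⟪p, e⟫ • e, hperp p, ?_⟩
      rw [h2]
      abel
    · rintro ⟨w, hw, rfl⟩
      have h0 : F (w + f w • e) = 0 := by rw [hF w _ hw, sub_self]
      have ho : IsOpen {p | 0 < F p} := isOpen_lt continuous_const hFc
      rw [ho.frontier_eq]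
      refine ⟨?_, fun h => ?_⟩
      · rw [Metric.mem_closure_iff]
        intro ε hε
        refine ⟨w + f w • e + (ε / 2) • e, ?_, ?_⟩
        · change 0 < F _
          rw [hFadd, h0]
          linarith
        · rw [dist_eq_norm, sub_add_cancel_left, norm_neg, norm_smul, hen,
            Real.norm_of_nonneg (by positivity)]
          linarith
      · have h' : 0 < F (w + f w • e) := h
        linarith
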